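/- For 0 < q < 1 and c > 0, the moment μ_n = Σ_{k=-∞}^∞ [(cq^k)^n + (−cq^k)^n] q^k / (−c²q^{2k}; q²)_∞ equals [1 + (−1)^n] q^{−n²/4} (q²;q²)_∞ (−c^{−2}q;q²)_∞ (−c²q;q²)_∞ / [(−c²;q²)_∞ (−c^{−2}q²;q²)_∞ (q^{n+1};q²)_∞]. -/

import Mathlib

open Finset

/-- infinite q-Pochhammer symbol `(a;Q)_∞ = ∏_{m=0}^∞ (1 - a Q^m)` -/
noncomputable def qPochInf (a Q : ℝ) : ℝ :=
  ∏' m : ℕ, (1 - a * Q ^ m)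

open Filter Topology

section QPochhammer

variable {Q : ℝ}

theorem summable_norm_neg_mul_pow (hQ : 0 < Q) (hQ1 : Q < 1) (a : ℝ) :
    Summable fun m : ℕ => ‖-(a * Q ^ m)‖ :=
  ((summable_geometric_of_lt_one hQ.le hQ1).mul_left a).neg.norm

theorem tendsto_prod_qPochInf (hQ : 0 < Q) (hQ1 : Q < 1) (a : ℝ) :
    Tendsto (fun m => ∏ i ∈ range m, (1 - a * Q ^ i)) atTop (𝓝 (qPochInf a Q)) := by
  have h := multipliable_one_add_of_summable (summable_norm_neg_mul_pow hQ hQ1 a)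
  simp only [← sub_eq_add_neg] at h
  exact h.hasProd.tendsto_prod_nat

theorem qPochInf_eq_mul (hQ : 0 < Q) (hQ1 : Q < 1) (a : ℝ) :
    qPochInf a Q = (1 - a) * qPochInf (a * Q) Q := by
  refine tendsto_nhds_unique ((tendsto_add_atTop_iff_nat 1).2 (tendsto_prod_qPochInf hQ hQ1 a)) ?_
  refine ((tendsto_prod_qPochInf hQ hQ1 (a * Q)).const_mul (1 - a)).congr fun m => ?_
  rw [prod_range_succ', mul_comm]
  simp [pow_succ', mul_assoc]

theorem qPochInf_eq_prod_mul (hQ : 0 < Q) (hQ1 : Q < 1) (a : ℝ) (m : ℕ) :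
    qPochInf a Q = (∏ i ∈ range m, (1 - a * Q ^ i)) * qPochInf (a * Q ^ m) Q := by
  induction m with
  | zero => simp
  | succ m ih =>
    rw [ih, prod_range_succ, qPochInf_eq_mul hQ hQ1 (a * Q ^ m), pow_succ]
    ring_nf

theorem qPochInf_ne_zero (hQ : 0 < Q) (hQ1 : Q < 1) {a : ℝ} (ha : a < 1) :
    qPochInf a Q ≠ 0 := by
  refine tprod_one_add_ne_zero_of_summable (f := fun m : ℕ => -(a * Q ^ m)) (fun m => ?_)
    (summable_norm_neg_mul_pow hQ hQ1 a)
  have h1 : Q ^ m ≤ 1 := pow_le_one₀ hQ.le hQ1.le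
  have h0 : 0 < Q ^ m := pow_pos hQ m
  have : a * Q ^ m < 1 := by
    rcases le_or_gt a 0 with h | h <;> nlinarith
  linarith

theorem tendsto_qPochInf_mul_pow (hQ : 0 < Q) (hQ1 : Q < 1) (a : ℝ) :
    Tendsto (fun m : ℕ => qPochInf (a * Q ^ m) Q) atTop (𝓝 1) := by
  have hlim : Tendsto (fun m : ℕ => a * Q ^ m) atTop (𝓝 0) := by
    simpa using (tendsto_pow_atTop_nhds_zero_of_lt_one hQ.le hQ1).const_mul a
  obtain ⟨N, hN⟩ := (hlim.eventually_lt_const one_pos).exists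
  have hne := qPochInf_ne_zero hQ hQ1 hN
  rw [← tendsto_add_atTop_iff_nat N]
  have h := (tendsto_const_nhds (x := qPochInf (a * Q ^ N) Q)).div
    (tendsto_prod_qPochInf hQ hQ1 (a * Q ^ N)) hne
  rw [div_self hne] at h
  refine h.congr fun m => ?_
  have hm := qPochInf_eq_prod_mul hQ hQ1 (a * Q ^ N) m
  have hprod : ∏ i ∈ range m, (1 - a * Q ^ N * Q ^ i) ≠ 0 := by
    intro h0
    rw [h0, zero_mul] at hm
    exact hne hm
  rw [Pi.div_apply, div_eq_iff hprod, pow_add, mul_comm (Q ^ m), ← mul_assoc, hm, mul_comm]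

theorem one_le_prod_one_sub (hQ : 0 < Q) {a : ℝ} (ha : a ≤ 0) (m : ℕ) :
    1 ≤ ∏ i ∈ range m, (1 - a * Q ^ i) := by
  induction m with
  | zero => simp
  | succ m ih =>
    rw [prod_range_succ]
    exact one_le_mul_of_one_le_of_one_le ih (by nlinarith [pow_pos hQ m])

theorem one_le_qPochInf (hQ : 0 < Q) (hQ1 : Q < 1) {a : ℝ} (ha : a ≤ 0) : 1 ≤ qPochInf a Q := by
  refine ge_of_tendsto' (tendsto_prod_qPochInf hQ hQ1 a) fun m => ?_
  exact one_le_prod_one_sub hQ ha m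

theorem qPochInf_mul_pow_le (hQ : 0 < Q) (hQ1 : Q < 1) {a : ℝ} (ha : a ≤ 0) (m : ℕ) :
    qPochInf (a * Q ^ m) Q ≤ qPochInf a Q := by
  rw [qPochInf_eq_prod_mul hQ hQ1 a m]
  exact le_mul_of_one_le_left (zero_le_one.trans (one_le_qPochInf hQ hQ1
    (mul_nonpos_of_nonpos_of_nonneg ha (by positivity)))) (one_le_prod_one_sub hQ ha m)

theorem abs_qPochInf_le_one (hQ : 0 < Q) (hQ1 : Q < 1) {a : ℝ} (ha : 0 ≤ a) (ha1 : a ≤ 1) :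
    |qPochInf a Q| ≤ 1 := by
  refine le_of_tendsto' (tendsto_prod_qPochInf hQ hQ1 a).abs fun m => ?_
  rw [Finset.abs_prod]
  refine Finset.prod_le_one (fun i _ => abs_nonneg _) fun i _ => ?_
  have h1 : Q ^ i ≤ 1 := pow_le_one₀ hQ.le hQ1.le
  have h0 : 0 < Q ^ i := pow_pos hQ i
  rw [abs_le]
  constructor <;> nlinarith

theorem qPochInf_zpow_eq_zero (hQ : 0 < Q) {k : ℤ} (hk : k ≤ 0) : qPochInf (Q ^ k) Q = 0 := by
  refine tprod_of_exists_eq_zero ⟨k.natAbs, ?_⟩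
  rw [← zpow_natCast, ← zpow_add₀ hQ.ne', Int.natCast_natAbs, abs_of_nonpos hk]
  simp

theorem abs_qPochInf_zpow_le_one (hQ : 0 < Q) (hQ1 : Q < 1) (k : ℤ) :
    |qPochInf (Q ^ k) Q| ≤ 1 := by
  rcases le_or_gt k 0 with hk | hk
  · simp [qPochInf_zpow_eq_zero hQ hk]
  · exact abs_qPochInf_le_one hQ hQ1 (by positivity) (zpow_le_one₀ hQ hQ1.le hk.le)

end QPochhammer

/-- The general term `x ^ k * (q ^ 2) ^ (k * (k - 1) / 2)` of the Jacobi theta series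
with nome `q ^ 2`. -/
noncomputable def thetaTerm (q x : ℝ) (k : ℤ) : ℝ :=
  x ^ k * q ^ (k * (k - 1))

section Theta

variable {q : ℝ}

theorem thetaTerm_pos (hq : 0 < q) {x : ℝ} (hx : 0 < x) (k : ℤ) : 0 < thetaTerm q x k := by
  unfold thetaTerm
  positivity

theorem thetaTerm_add_one (hq : 0 < q) {x : ℝ} (hx : 0 < x) (k : ℤ) :
    thetaTerm q x (k + 1) = x * (q ^ 2) ^ k * thetaTerm q x k := by
  unfold thetaTerm
  rw [zpow_add_one₀ hx.ne', ← zpow_natCast q 2, ← zpow_mul,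
    show (k + 1) * (k + 1 - 1) = (2 : ℕ) * k + k * (k - 1) by push_cast; ring, zpow_add₀ hq.ne']
  ring

theorem thetaTerm_neg (hq : 0 < q) (x : ℝ) (k : ℤ) :
    thetaTerm q x (-k) = thetaTerm q (q ^ 2 / x) k := by
  unfold thetaTerm
  rw [div_zpow, zpow_neg, div_eq_mul_inv, ← zpow_natCast q 2, ← zpow_mul,
    show -k * (-k - 1) = (2 : ℕ) * k + k * (k - 1) by push_cast; ring, zpow_add₀ hq.ne']
  ring

theorem thetaTerm_mul (x y : ℝ) (k : ℤ) : thetaTerm q (x * y) k = y ^ k * thetaTerm q x k := by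
  unfold thetaTerm
  rw [mul_zpow]
  ring

theorem summable_thetaTerm_nat (hq : 0 < q) (hq1 : q < 1) {x : ℝ} (hx : 0 < x) :
    Summable fun n : ℕ => thetaTerm q x n := by
  refine summable_of_ratio_test_tendsto_lt_one (l := 0) one_pos
    (.of_forall fun n => (thetaTerm_pos hq hx n).ne') ?_
  have h : Tendsto (fun n : ℕ => x * (q ^ 2) ^ n) atTop (𝓝 0) := by
    simpa using (tendsto_pow_atTop_nhds_zero_of_lt_one (by positivity : 0 ≤ q ^ 2)
      (by nlinarith)).const_mul x
  refine h.congr fun n => ?_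
  rw [← norm_div, Nat.cast_add_one, thetaTerm_add_one hq hx,
    mul_div_cancel_right₀ _ (thetaTerm_pos hq hx n).ne', zpow_natCast, Real.norm_of_nonneg]
  positivity

theorem summable_thetaTerm (hq : 0 < q) (hq1 : q < 1) {x : ℝ} (hx : 0 < x) :
    Summable (thetaTerm q x) := by
  refine Summable.of_nat_of_neg (summable_thetaTerm_nat hq hq1 hx) ?_
  simp only [thetaTerm_neg hq]
  exact summable_thetaTerm_nat hq hq1 (by positivity)

theorem tsum_thetaTerm_mul_qPochInf (hq : 0 < q) (hq1 : q < 1) {x : ℝ} (hx : 0 < x) (v : ℝ)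
    {b : ℤ → ℝ} (hb : Summable b)
    (hvb : ∀ (m : ℕ) (k : ℤ),
      |thetaTerm q x k * qPochInf (v * (q ^ 2) ^ (k + 1) * (q ^ 2) ^ m) (q ^ 2)| ≤ b k) :
    qPochInf (-(v * q ^ 2 / x)) (q ^ 2) *
        ∑' k, thetaTerm q x k * qPochInf (v * (q ^ 2) ^ (k + 1)) (q ^ 2) =
      ∑' k, thetaTerm q x k := by
  have hQ : 0 < q ^ 2 := by positivity
  have hQ1 : q ^ 2 < 1 := by nlinarith
  set S : ℕ → ℝ := fun m =>
    ∑' k, thetaTerm q x k * qPochInf (v * (q ^ 2) ^ (k + 1) * (q ^ 2) ^ m) (q ^ 2) with hS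
  have hsum (m : ℕ) : Summable fun k =>
      thetaTerm q x k * qPochInf (v * (q ^ 2) ^ (k + 1) * (q ^ 2) ^ m) (q ^ 2) :=
    hb.of_norm_bounded (hvb m)
  have hrec (m : ℕ) : S (m + 1) = (1 - -(v * q ^ 2 / x) * (q ^ 2) ^ m) * S m := by
    have hshift : S m = ∑' k : ℤ, thetaTerm q x (k + 1) *
        qPochInf (v * (q ^ 2) ^ (k + 1 + 1) * (q ^ 2) ^ m) (q ^ 2) :=
      ((Equiv.addRight (1 : ℤ)).tsum_eq _).symm
    have hS' : S (m + 1) = S m + v * q ^ 2 / x * (q ^ 2) ^ m * S m := by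
      nth_rewrite 2 [hshift]
      rw [← tsum_mul_left, hS]
      rw [← (hsum m).tsum_add]
      · refine tsum_congr fun k => ?_
        rw [qPochInf_eq_mul hQ hQ1 (v * (q ^ 2) ^ (k + 1) * (q ^ 2) ^ m),
          thetaTerm_add_one hq hx, zpow_add_one₀ hQ.ne' (k + 1), zpow_add_one₀ hQ.ne' k, pow_succ _ m,
          show v * ((q ^ 2) ^ k * q ^ 2) * (q ^ 2) ^ m * q ^ 2 =
            v * ((q ^ 2) ^ k * q ^ 2 * q ^ 2) * (q ^ 2) ^ m by ring,
          show v * ((q ^ 2) ^ k * q ^ 2) * ((q ^ 2) ^ m * q ^ 2) =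
            v * ((q ^ 2) ^ k * q ^ 2 * q ^ 2) * (q ^ 2) ^ m by ring]
        field_simp
        ring
      · exact ((Equiv.addRight (1 : ℤ)).summable_iff.2 (hsum m)).mul_left _
    rw [hS']
    ring
  have hprod (m : ℕ) : S m = (∏ i ∈ range m, (1 - -(v * q ^ 2 / x) * (q ^ 2) ^ i)) * S 0 := by
    induction m with
    | zero => simp
    | succ m ih => rw [hrec, ih, prod_range_succ]; ring
  have hlim : Tendsto S atTop (𝓝 (∑' k, thetaTerm q x k)) := by
    refine tendsto_tsum_of_dominated_convergence hb (fun k => ?_) (.of_forall hvb)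
    simpa using (tendsto_qPochInf_mul_pow hQ hQ1 (v * (q ^ 2) ^ (k + 1))).const_mul
      (thetaTerm q x k)
  have hlim' := ((tendsto_prod_qPochInf hQ hQ1 (-(v * q ^ 2 / x))).mul_const (S 0)).congr
    fun m => (hprod m).symm
  have := tendsto_nhds_unique hlim' hlim
  simpa [hS] using this

/-- Euler's expansion of `(-x; q ^ 2)_∞`, written as a bilateral series. -/
theorem tsum_thetaTerm_mul_qPochInf_zpow (hq : 0 < q) (hq1 : q < 1) {x : ℝ} (hx : 0 < x) :
    ∑' k, thetaTerm q x k * qPochInf ((q ^ 2) ^ (k + 1)) (q ^ 2) =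
      qPochInf (-x) (q ^ 2) * qPochInf (q ^ 2) (q ^ 2) := by
  have hQ : 0 < q ^ 2 := by positivity
  have hQ1 : q ^ 2 < 1 := by nlinarith
  set e : ℤ → ℝ := fun k => qPochInf ((q ^ 2) ^ (k + 1)) (q ^ 2) with he
  have he1 (k : ℤ) : |e k| ≤ 1 := abs_qPochInf_zpow_le_one hQ hQ1 _
  have hbound (m : ℕ) (k : ℤ) : ‖thetaTerm q (x * (q ^ 2) ^ m) k * e k‖ ≤ thetaTerm q x k := by
    have ht := thetaTerm_pos hq hx k
    rcases lt_or_ge k 0 with hk | hk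
    · have hek : e k = 0 := qPochInf_zpow_eq_zero hQ (by omega)
      simpa [hek] using ht.le
    · have h1 : ((q ^ 2) ^ m) ^ k ≤ 1 :=
        zpow_le_one₀ (by positivity) (pow_le_one₀ hQ.le hQ1.le) hk
      rw [norm_mul, thetaTerm_mul, Real.norm_of_nonneg (by positivity)]
      calc _ ≤ 1 * thetaTerm q x k * 1 := by
            gcongr
            exact he1 k
        _ = _ := by ring
  set G : ℕ → ℝ := fun m => ∑' k, thetaTerm q (x * (q ^ 2) ^ m) k * e k with hG
  have hsum (m : ℕ) : Summable fun k => thetaTerm q (x * (q ^ 2) ^ m) k * e k :=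
    (summable_thetaTerm hq hq1 hx).of_norm_bounded (hbound m)
  have hrec (m : ℕ) : G m = (1 - -x * (q ^ 2) ^ m) * G (m + 1) := by
    have hstep (k : ℤ) : e k = (1 - (q ^ 2) ^ (k + 1)) * e (k + 1) := by
      simp only [he]
      rw [qPochInf_eq_mul hQ hQ1, ← zpow_add_one₀ hQ.ne']
    have hshift : G m = ∑' k : ℤ, thetaTerm q (x * (q ^ 2) ^ m) (k + 1) * e (k + 1) :=
      ((Equiv.addRight (1 : ℤ)).tsum_eq _).symm
    have hshift' : G (m + 1) = ∑' k : ℤ, thetaTerm q (x * (q ^ 2) ^ (m + 1)) (k + 1) * e (k + 1) :=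
      ((Equiv.addRight (1 : ℤ)).tsum_eq _).symm
    have hsplit : G m = G (m + 1) + x * (q ^ 2) ^ m * G (m + 1) := by
      nth_rewrite 1 [hshift']
      rw [hshift, hG, ← tsum_mul_left, ← Summable.tsum_add]
      · refine tsum_congr fun k => ?_
        have hxm : 0 < x * (q ^ 2) ^ m := by positivity
        rw [hstep k, pow_succ _ m, ← mul_assoc, thetaTerm_mul _ (q ^ 2), thetaTerm_mul _ (q ^ 2),
          thetaTerm_add_one hq hxm, zpow_add_one₀ hQ.ne']
        ring
      · exact (Equiv.addRight (1 : ℤ)).summable_iff.2 (hsum (m + 1))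
      · exact (hsum (m + 1)).mul_left _
    rw [hsplit]
    ring
  have hprod (m : ℕ) : G 0 = (∏ i ∈ range m, (1 - -x * (q ^ 2) ^ i)) * G m := by
    induction m with
    | zero => simp
    | succ m ih => rw [ih, hrec, prod_range_succ]; ring
  have hlim : Tendsto G atTop (𝓝 (∑' k : ℤ, if k = 0 then e 0 else 0)) := by
    refine tendsto_tsum_of_dominated_convergence (summable_thetaTerm hq hq1 hx) (fun k => ?_)
      (.of_forall hbound)
    rcases lt_trichotomy k 0 with hk | rfl | hk
    · have : e k = 0 := qPochInf_zpow_eq_zero hQ (by omega)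
      simp [this, hk.ne]
    · simp [thetaTerm]
    · lift k to ℕ using hk.le
      have hk0 : k ≠ 0 := by omega
      have h0 : Tendsto (fun m : ℕ => ((q ^ 2) ^ k) ^ m) atTop (𝓝 0) :=
        tendsto_pow_atTop_nhds_zero_of_lt_one (by positivity) (pow_lt_one₀ hQ.le hQ1 hk0)
      have h1 := h0.mul_const (thetaTerm q x k * e k)
      simp only [zero_mul] at h1
      simp only [Nat.cast_eq_zero, hk0, if_false]
      refine h1.congr fun m => ?_
      rw [thetaTerm_mul, zpow_natCast, pow_right_comm, mul_assoc]
  rw [tsum_ite_eq] at hlim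
  have h := tendsto_nhds_unique (tendsto_const_nhds (x := G 0))
    (((tendsto_prod_qPochInf hQ hQ1 (-x)).mul hlim).congr fun m => (hprod m).symm)
  simpa [hG, he] using h

/-- **Jacobi triple product identity**. -/
theorem tsum_thetaTerm (hq : 0 < q) (hq1 : q < 1) {x : ℝ} (hx : 0 < x) :
    ∑' k, thetaTerm q x k =
      qPochInf (q ^ 2) (q ^ 2) * qPochInf (-x) (q ^ 2) * qPochInf (-(q ^ 2 / x)) (q ^ 2) := by
  have hQ : 0 < q ^ 2 := by positivity
  have hQ1 : q ^ 2 < 1 := by nlinarith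
  have h := tsum_thetaTerm_mul_qPochInf hq hq1 hx 1 (summable_thetaTerm hq hq1 hx) fun m k => by
    rw [one_mul, ← zpow_natCast _ m, ← zpow_add₀ hQ.ne', abs_mul, abs_of_pos (thetaTerm_pos hq hx k)]
    exact mul_le_of_le_one_right (thetaTerm_pos hq hx k).le (abs_qPochInf_zpow_le_one hQ hQ1 _)
  simp only [one_mul] at h
  rw [← h, tsum_thetaTerm_mul_qPochInf_zpow hq hq1 hx]
  ring

/-- Quasi-periodicity of the theta product `(-x; q ^ 2)_∞ (-q ^ 2 / x; q ^ 2)_∞`. -/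
theorem thetaTerm_mul_qPochInf_mul_qPochInf (hq : 0 < q) (hq1 : q < 1) {x : ℝ} (hx : 0 < x)
    (k : ℤ) :
    thetaTerm q x k * (qPochInf (-(x * (q ^ 2) ^ k)) (q ^ 2) *
        qPochInf (-(q ^ 2 / (x * (q ^ 2) ^ k))) (q ^ 2)) =
      qPochInf (-x) (q ^ 2) * qPochInf (-(q ^ 2 / x)) (q ^ 2) := by
  have hQ : 0 < q ^ 2 := by positivity
  have hQ1 : q ^ 2 < 1 := by nlinarith
  have hstep (k : ℤ) :
      thetaTerm q x (k + 1) * (qPochInf (-(x * (q ^ 2) ^ (k + 1))) (q ^ 2) *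
        qPochInf (-(q ^ 2 / (x * (q ^ 2) ^ (k + 1)))) (q ^ 2)) =
      thetaTerm q x k * (qPochInf (-(x * (q ^ 2) ^ k)) (q ^ 2) *
        qPochInf (-(q ^ 2 / (x * (q ^ 2) ^ k))) (q ^ 2)) := by
    have hy : 0 < x * (q ^ 2) ^ k := by positivity
    rw [thetaTerm_add_one hq hx, zpow_add_one₀ hQ.ne', ← mul_assoc x]
    generalize x * (q ^ 2) ^ k = y at hy
    rw [qPochInf_eq_mul hQ hQ1 (-y), qPochInf_eq_mul hQ hQ1 (-(q ^ 2 / (y * q ^ 2))),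
      show q ^ 2 / (y * q ^ 2) = 1 / y by field_simp,
      show -(1 / y) * q ^ 2 = -(q ^ 2 / y) by ring, neg_mul y]
    field_simp
    ring
  induction k using Int.induction_on with
  | zero => simp [thetaTerm]
  | succ k ih => rw [hstep, ih]
  | pred k ih => rw [← ih, ← hstep, sub_add_cancel]

theorem summable_zpow_div_qPochInf (hq : 0 < q) (hq1 : q < 1) {a z : ℝ} (ha : 0 < a) (hz : 0 < z)
    (hz1 : z < 1) : Summable fun k : ℤ => z ^ k / qPochInf (-(a * (q ^ 2) ^ k)) (q ^ 2) := by
  have hQ : 0 < q ^ 2 := by positivity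
  have hQ1 : q ^ 2 < 1 := by nlinarith
  have hge (y : ℝ) (hy : 0 < y) : 1 ≤ qPochInf (-y) (q ^ 2) :=
    one_le_qPochInf hQ hQ1 (neg_nonpos.2 hy.le)
  refine Summable.of_nat_of_neg ?_ ?_
  · refine (summable_geometric_of_lt_one hz.le hz1).of_norm_bounded fun n => ?_
    have h1 := hge (a * (q ^ 2) ^ (n : ℤ)) (by positivity)
    rw [norm_div, zpow_natCast z n, Real.norm_of_nonneg (by positivity),
      Real.norm_of_nonneg (by linarith)]
    exact div_le_self (by positivity) h1
  · have hs := (summable_thetaTerm_nat hq hq1 (x := q ^ 2 / (a * z)) (by positivity)).mul_right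
      (qPochInf (-(q ^ 2 / a)) (q ^ 2))
    refine hs.of_norm_bounded fun n => ?_
    have h1 := hge (a * (q ^ 2) ^ (-(n : ℤ))) (by positivity)
    have h2 := hge (q ^ 2 / (a * (q ^ 2) ^ (-(n : ℤ)))) (by positivity)
    have hth := hge a ha
    have hth' := hge (q ^ 2 / a) (by positivity)
    have hquasi := thetaTerm_mul_qPochInf_mul_qPochInf hq hq1 ha (-(n : ℤ))
    have hle : qPochInf (-(q ^ 2 / (a * (q ^ 2) ^ (-(n : ℤ))))) (q ^ 2) ≤
        qPochInf (-(q ^ 2 / a)) (q ^ 2) := by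
      have := qPochInf_mul_pow_le hQ hQ1 (a := -(q ^ 2 / a)) (neg_nonpos.2 (by positivity)) n
      convert this using 2
      rw [zpow_neg, zpow_natCast]
      field_simp
    have ht := thetaTerm_pos hq ha (-(n : ℤ))
    rw [Real.norm_of_nonneg (by positivity), ← thetaTerm_neg hq, thetaTerm_mul,
      div_le_iff₀ (by linarith), mul_assoc, mul_assoc]
    refine le_mul_of_one_le_right (by positivity) ?_
    have h3 : 1 ≤ thetaTerm q a (-(n : ℤ)) * (qPochInf (-(a * (q ^ 2) ^ (-(n : ℤ)))) (q ^ 2) *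
        qPochInf (-(q ^ 2 / (a * (q ^ 2) ^ (-(n : ℤ))))) (q ^ 2)) := by
      rw [hquasi]
      exact one_le_mul_of_one_le_of_one_le hth hth'
    refine h3.trans (mul_le_mul_of_nonneg_left ?_ ht.le)
    rw [mul_comm]
    gcongr

/-- The case `b = 0` of Ramanujan's `₁ψ₁` summation, for a negative numerator parameter `-a`. -/
theorem hasSum_zpow_div_qPochInf (hq : 0 < q) (hq1 : q < 1) {a z : ℝ} (ha : 0 < a) (hz : 0 < z)
    (hz1 : z < 1) :
    HasSum (fun k : ℤ => z ^ k / qPochInf (-(a * (q ^ 2) ^ k)) (q ^ 2))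
      (qPochInf (q ^ 2) (q ^ 2) * qPochInf (-(a * z)) (q ^ 2) * qPochInf (-(q ^ 2 / (a * z))) (q ^ 2)
        / (qPochInf (-a) (q ^ 2) * qPochInf (-(q ^ 2 / a)) (q ^ 2) * qPochInf z (q ^ 2))) := by
  have hQ : 0 < q ^ 2 := by positivity
  have hQ1 : q ^ 2 < 1 := by nlinarith
  have hpos (y : ℝ) (hy : 0 < y) : 0 < qPochInf (-y) (q ^ 2) :=
    zero_lt_one.trans_le (one_le_qPochInf hQ hQ1 (neg_nonpos.2 hy.le))
  have hx : 0 < q ^ 2 / (a * z) := by positivity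
  have hsum := summable_zpow_div_qPochInf hq hq1 ha hz hz1
  have hterm (k : ℤ) : thetaTerm q (q ^ 2 / (a * z)) k *
      qPochInf (-(1 / a) * (q ^ 2) ^ (k + 1)) (q ^ 2) =
      qPochInf (-a) (q ^ 2) * qPochInf (-(q ^ 2 / a)) (q ^ 2) *
        (z ^ (-k) / qPochInf (-(a * (q ^ 2) ^ (-k))) (q ^ 2)) := by
    have h1 := hpos (a * (q ^ 2) ^ (-k)) (by positivity)
    rw [← thetaTerm_mul_qPochInf_mul_qPochInf hq hq1 ha (-k), ← thetaTerm_neg hq,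
      thetaTerm_mul, show -(1 / a) * (q ^ 2) ^ (k + 1) = -(q ^ 2 / (a * (q ^ 2) ^ (-k))) by
        rw [zpow_add_one₀ hQ.ne', zpow_neg]; field_simp]
    field_simp
  have hsum' : Summable fun k : ℤ => thetaTerm q (q ^ 2 / (a * z)) k *
      qPochInf (-(1 / a) * (q ^ 2) ^ (k + 1)) (q ^ 2) := by
    simp only [hterm]
    exact ((Equiv.neg ℤ).summable_iff.2 hsum).mul_left _
  have key := tsum_thetaTerm_mul_qPochInf hq hq1 hx (-(1 / a)) hsum' fun m k => by
    have hneg : -(1 / a) * (q ^ 2) ^ (k + 1) ≤ 0 :=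
      mul_nonpos_of_nonpos_of_nonneg (neg_nonpos.2 (by positivity)) (by positivity)
    have hneg' : -(1 / a) * (q ^ 2) ^ (k + 1) * (q ^ 2) ^ m ≤ 0 :=
      mul_nonpos_of_nonpos_of_nonneg hneg (by positivity)
    have ht := thetaTerm_pos hq hx k
    rw [abs_of_nonneg (mul_nonneg ht.le (zero_le_one.trans (one_le_qPochInf hQ hQ1 hneg')))]
    exact mul_le_mul_of_nonneg_left (qPochInf_mul_pow_le hQ hQ1 hneg m) ht.le
  have hreindex : ∑' k : ℤ, z ^ (-k) / qPochInf (-(a * (q ^ 2) ^ (-k))) (q ^ 2) =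
      ∑' k : ℤ, z ^ k / qPochInf (-(a * (q ^ 2) ^ k)) (q ^ 2) :=
    (Equiv.neg ℤ).tsum_eq fun k : ℤ => z ^ k / qPochInf (-(a * (q ^ 2) ^ k)) (q ^ 2)
  rw [tsum_congr hterm, tsum_mul_left, hreindex, tsum_thetaTerm hq hq1 hx,
    show -(-(1 / a) * q ^ 2 / (q ^ 2 / (a * z))) = z by field_simp,
    show q ^ 2 / (q ^ 2 / (a * z)) = a * z by field_simp] at key
  have hz0 := qPochInf_ne_zero hQ hQ1 hz1
  have ha0 := (hpos a ha).ne'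
  have ha0' := (hpos (q ^ 2 / a) (by positivity)).ne'
  convert hsum.hasSum using 1
  rw [div_eq_iff (by positivity)]
  linear_combination -key

end Theta

/-- The moments of the discrete q-Hermite II orthogonality measure:
`Σ_{k=-∞}^∞ [(cq^k)^n + (−cq^k)^n] q^k / (−c²q^{2k};q²)_∞
  = [1+(−1)^n] q^{−n²/4} (q²;q²)_∞ (−c^{−2}q;q²)_∞ (−c²q;q²)_∞
    / ((−c²;q²)_∞ (−c^{−2}q²;q²)_∞ (q^{n+1};q²)_∞)`. -/
theorem discrete_q_hermite_II_moments (q c : ℝ) (hq : 0 < q) (hq1 : q < 1)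
    (hc : 0 < c) (n : ℕ) :
    HasSum
      (fun k : ℤ =>
        ((c * q ^ k) ^ n + (-(c * q ^ k)) ^ n) * q ^ k /
          ∏' m : ℕ, (1 + c ^ 2 * q ^ (2 * k) * (q ^ 2) ^ m))
      ((1 + (-1 : ℝ) ^ n) * q ^ (-(n : ℝ) ^ 2 / 4) *
          qPochInf (q ^ 2) (q ^ 2) * qPochInf (-(q / c ^ 2)) (q ^ 2) *
          qPochInf (-(c ^ 2 * q)) (q ^ 2) /
        (qPochInf (-(c ^ 2)) (q ^ 2) * qPochInf (-(q ^ 2 / c ^ 2)) (q ^ 2) *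
          qPochInf (q ^ (n + 1)) (q ^ 2))) := by
  have hQ : 0 < q ^ 2 := by positivity
  have hQ1 : q ^ 2 < 1 := by nlinarith
  have hden (k : ℤ) : ∏' m : ℕ, (1 + c ^ 2 * q ^ (2 * k) * (q ^ 2) ^ m) =
      qPochInf (-(c ^ 2 * (q ^ 2) ^ k)) (q ^ 2) := by
    refine tprod_congr fun m => ?_
    rw [zpow_mul, zpow_ofNat]
    ring
  simp only [hden]
  rcases Nat.even_or_odd n with hn | hn
  · obtain ⟨s, rfl⟩ := hn
    have ha : 0 < c ^ 2 := by positivity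
    have hpow : q ^ (-((s + s : ℕ) : ℝ) ^ 2 / 4) = (q ^ (s ^ 2))⁻¹ := by
      rw [← Real.rpow_natCast q, ← Real.rpow_neg hq.le]
      congr 1
      push_cast
      ring
    have h := (hasSum_zpow_div_qPochInf hq hq1 ha (pow_pos hq (s + s + 1))
      (pow_lt_one₀ hq.le hq1 (by omega))).mul_left (2 * c ^ (s + s))
    refine (congrArg₂ (HasSum · ·) (funext fun k => ?_) ?_).mpr h
    · rw [Even.neg_pow ⟨s, rfl⟩, pow_succ q (s + s), mul_zpow, mul_pow, ← zpow_natCast (q ^ k),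
        ← zpow_natCast q (s + s), ← zpow_mul, ← zpow_mul, mul_comm k]
      ring
    · have hquasi := thetaTerm_mul_qPochInf_mul_qPochInf hq hq1 (mul_pos ha hq) s
      have hterm : thetaTerm q (c ^ 2 * q) s = c ^ (s + s) * q ^ (s ^ 2) := by
        rw [thetaTerm, zpow_natCast, mul_pow, mul_assoc, ← zpow_natCast q s, ← zpow_add₀ hq.ne',
          show (s : ℤ) + s * (s - 1) = (s ^ 2 : ℕ) by push_cast; ring, zpow_natCast]
        ring
      rw [hterm, zpow_natCast, show c ^ 2 * q * (q ^ 2) ^ s = c ^ 2 * q ^ (s + s + 1) by ring,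
        show q ^ 2 / (c ^ 2 * q) = q / c ^ 2 by field_simp] at hquasi
      rw [Even.neg_one_pow ⟨s, rfl⟩, hpow, ← mul_div_assoc]
      congr 1
      have hinv : (q ^ (s ^ 2))⁻¹ * q ^ (s ^ 2) = 1 := inv_mul_cancel₀ (by positivity)
      linear_combination -2 * (q ^ (s ^ 2))⁻¹ * qPochInf (q ^ 2) (q ^ 2) * hquasi +
        2 * c ^ (s + s) * qPochInf (q ^ 2) (q ^ 2) * qPochInf (-(c ^ 2 * q ^ (s + s + 1))) (q ^ 2) *
          qPochInf (-(q ^ 2 / (c ^ 2 * q ^ (s + s + 1)))) (q ^ 2) * hinv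
  · simp [hn.neg_pow]
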